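/- Let X be a locally compact Hausdorff space, H a separable complex Hilbert space, p ∈ [1,∞), and let T : X → B(H) be bounded and *-strongly continuous. Then the following are equivalent: (a) T(x) ∈ S_p(H) for every x ∈ X and the function x ↦ tr|T(x)|^p lies in C₀(X); (b) T ∈ C₀(X, S_p(H)), i.e., x ↦ T(x) is continuous with respect to the Schatten norm ‖·‖_p and vanishes at infinity with respect to ‖·‖_p. -/

import Mathlib

open ContinuousLinearMap Filter Topology

noncomputable section

variable {H : Type*} [NormedAddCommGroup H] [InnerProductSpace ℂ H] [CompleteSpace H]
  [TopologicalSpace.SeparableSpace H]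

local notation "⟪" x ", " y "⟫" => @inner ℂ _ _ x y

/-- `|T|^p = (T*T)^{p/2}`, via the continuous functional calculus. -/
def absPow (T : H →L[ℂ] H) (p : ℝ) : H →L[ℂ] H :=
  cfc (fun t : ℝ => t ^ (p / 2)) (ContinuousLinearMap.adjoint T ∘L T)

/-- The trace `∑ᵢ ⟨fᵢ, A fᵢ⟩ ∈ [0,∞]` of a positive operator `A`, computed in the
orthonormal basis `f` (for positive `A` the value is independent of the basis). -/
def posTr (f : HilbertBasis ℕ ℂ H) (A : H →L[ℂ] H) : ENNReal :=
  ∑' i, ENNReal.ofReal (RCLike.re ⟪f i, A (f i)⟫)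

/-- `tr |T|^p ∈ [0,∞]`. `T` lies in the Schatten class `S_p(H)` iff this is finite. -/
def trAbsPow (f : HilbertBasis ℕ ℂ H) (T : H →L[ℂ] H) (p : ℝ) : ENNReal :=
  posTr f (absPow T p)

/-- The Schatten `p`-norm `‖T‖_p = (tr |T|^p)^{1/p}`. -/
def sNorm (f : HilbertBasis ℕ ℂ H) (p : ℝ) (T : H →L[ℂ] H) : ℝ :=
  (trAbsPow f T p).toReal ^ (1 / p)

/-- `T : X → B(H)` belongs to `C₀(X, S_p(H))`: pointwise Schatten class, continuous
with respect to the Schatten `p`-norm, and vanishing at infinity with respect to it. -/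
def IsC0Schatten (f : HilbertBasis ℕ ℂ H) (p : ℝ) {X : Type*} [TopologicalSpace X]
    (T : X → H →L[ℂ] H) : Prop :=
  (∀ x, trAbsPow f (T x) p ≠ ⊤) ∧
  (∀ x, Tendsto (fun y => sNorm f p (T y - T x)) (nhds x) (nhds 0)) ∧
  Tendsto (fun x => sNorm f p (T x)) (cocompact X) (nhds 0)

section ENNRealSums

variable {ι : Type*}

theorem ENNReal.tsum_mul_le_sqrt_mul_sqrt (a b : ι → ENNReal) :
    ∑' i, a i * b i ≤ (∑' i, a i ^ 2) ^ (1 / 2 : ℝ) * (∑' i, b i ^ 2) ^ (1 / 2 : ℝ) := by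
  rw [ENNReal.tsum_eq_iSup_sum]
  refine iSup_le fun s => (ENNReal.inner_le_Lp_mul_Lq s a b Real.HolderConjugate.two_two).trans ?_
  simp only [ENNReal.rpow_two]
  gcongr <;> exact ENNReal.sum_le_tsum s

theorem ENNReal.tsum_mul_rpow_le {p : ℝ} (hp : 1 ≤ p) (c a : ι → ENNReal) (hc : ∑' i, c i ≤ 1) :
    (∑' i, c i * a i) ^ p ≤ ∑' i, c i * a i ^ p := by
  have hp0 : 0 < p := by linarith
  rw [← ENNReal.le_rpow_inv_iff hp0, ENNReal.tsum_eq_iSup_sum]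
  refine iSup_le fun s => (ENNReal.inner_le_weight_mul_Lp_of_nonneg s hp c a).trans ?_
  calc (∑ i ∈ s, c i) ^ (1 - p⁻¹) * (∑ i ∈ s, c i * a i ^ p) ^ p⁻¹
      ≤ 1 ^ (1 - p⁻¹) * (∑' i, c i * a i ^ p) ^ p⁻¹ := by
        gcongr
        · exact sub_nonneg.2 (inv_le_one_of_one_le₀ hp)
        · exact (ENNReal.sum_le_tsum s).trans hc
        · exact ENNReal.sum_le_tsum s
    _ = _ := by simp

theorem ENNReal.tsum_Lp_add_le {p : ℝ} (hp : 1 ≤ p) (a b : ι → ENNReal) :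
    ∑' i, (a i + b i) ^ p ≤
      ((∑' i, a i ^ p) ^ (1 / p) + (∑' i, b i ^ p) ^ (1 / p)) ^ p := by
  have hp0 : 0 < p := by linarith
  rw [ENNReal.tsum_eq_iSup_sum]
  refine iSup_le fun s => ?_
  rw [← ENNReal.rpow_inv_le_iff hp0, ← one_div]
  refine (ENNReal.Lp_add_le s a b hp).trans ?_
  gcongr <;> exact ENNReal.sum_le_tsum s

end ENNRealSums

section Hilbert

universe u

variable {E : Type u} [NormedAddCommGroup E] [InnerProductSpace ℂ E] {ι : Type*}

theorem enorm_inner_comm (x y : E) : ‖inner ℂ x y‖ₑ = ‖inner ℂ y x‖ₑ := by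
  rw [← ofReal_norm, ← ofReal_norm, norm_inner_symm]

theorem Orthonormal.tsum_enorm_inner_sq_le {v : ι → E} (hv : Orthonormal ℂ v) (x : E) :
    ∑' i, ‖inner ℂ (v i) x‖ₑ ^ 2 ≤ ‖x‖ₑ ^ 2 := by
  have h := hv.tsum_inner_products_le x
  have e : ∀ z : ℂ, ‖z‖ₑ ^ 2 = ENNReal.ofReal (‖z‖ ^ 2) := fun z => by
    rw [← ofReal_norm, ENNReal.ofReal_pow (norm_nonneg _)]
  simp_rw [e]
  rw [← ENNReal.ofReal_tsum_of_nonneg (fun _ => by positivity) (hv.inner_products_summable x),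
    ← ofReal_norm, ← ENNReal.ofReal_pow (norm_nonneg _)]
  exact ENNReal.ofReal_le_ofReal h

theorem HilbertBasis.tsum_enorm_inner_sq (e : HilbertBasis ι ℂ E) (x : E) :
    ∑' i, ‖inner ℂ (e i) x‖ₑ ^ 2 = ‖x‖ₑ ^ 2 := by
  have h := (e.hasSum_inner_mul_inner x x).mapL Complex.reCLM
  have e1 : ∀ i, Complex.reCLM (inner ℂ x (e i) * inner ℂ (e i) x) = ‖inner ℂ (e i) x‖ ^ 2 := by
    intro i
    rw [← inner_conj_symm, ← Complex.normSq_eq_conj_mul_self, Complex.normSq_eq_norm_sq]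
    exact Complex.ofReal_re _
  have e2 : Complex.reCLM (inner ℂ x x) = ‖x‖ ^ 2 := inner_self_eq_norm_sq (𝕜 := ℂ) x
  simp_rw [e1] at h
  rw [e2] at h
  have e : ∀ z : ℂ, ‖z‖ₑ ^ 2 = ENNReal.ofReal (‖z‖ ^ 2) := fun z => by
    rw [← ofReal_norm, ENNReal.ofReal_pow (norm_nonneg _)]
  simp_rw [e]
  rw [← ENNReal.ofReal_tsum_of_nonneg (fun _ => by positivity) h.summable, h.tsum_eq,
    ← ofReal_norm, ← ENNReal.ofReal_pow (norm_nonneg _)]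

variable [CompleteSpace E]

/-- A compact self-adjoint operator is diagonal in some Hilbert basis. -/
theorem IsCompactOperator.exists_hilbertBasis_eigenvectors {D : E →L[ℂ] E}
    (hD : IsCompactOperator D) (hsa : IsSelfAdjoint D) :
    ∃ (κ : Type u) (e : HilbertBasis κ ℂ E) (d : κ → ℝ), ∀ j, D (e j) = (d j : ℂ) • e j := by
  have hsym : (D : E →ₗ[ℂ] E).IsSymmetric := hsa.isSymmetric
  have hfam := hsym.orthogonalFamily_eigenspaces
  choose w b hb using fun μ : ℂ =>
    exists_hilbertBasis ℂ (Module.End.eigenspace (D : E →ₗ[ℂ] E) μ)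
  have hon := hfam.orthonormal_sigma_orthonormal (fun μ => (b μ).orthonormal)
  have hbot : (Submodule.span ℂ (Set.range fun a : Σ μ, w μ =>
      (Module.End.eigenspace (D : E →ₗ[ℂ] E) a.1).subtypeₗᵢ (b a.1 a.2)))ᗮ = ⊥ := by
    rw [eq_bot_iff, ← ContinuousLinearMap.orthogonalComplement_iSup_eigenspaces_eq_bot hD hsym]
    intro x hx
    rw [Submodule.mem_orthogonal'] at hx
    rw [← Submodule.iInf_orthogonal, Submodule.mem_iInf]
    intro μ
    rw [Submodule.mem_orthogonal']
    intro u hu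
    set K := Module.End.eigenspace (D : E →ₗ[ℂ] E) μ
    have h1 := ((b μ).hasSum_repr ⟨u, hu⟩).mapL ((innerSL ℂ x).comp K.subtypeL)
    refine h1.unique ?_
    convert hasSum_zero with j
    have := hx _ (Submodule.subset_span ⟨⟨μ, j⟩, rfl⟩)
    simp only [Submodule.coe_subtypeₗᵢ, Submodule.coe_subtype] at this
    simp [this]
  have hdiag : ∀ a : Σ μ, w μ, D (b a.1 a.2 : E) = (a.1.re : ℂ) • (b a.1 a.2 : E) := by
    intro a
    have hv : D (b a.1 a.2 : E) = a.1 • (b a.1 a.2 : E) :=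
      Module.End.mem_eigenspace_iff.1 (b a.1 a.2).2
    have hne : (b a.1 a.2 : E) ≠ 0 := by
      simpa using (b a.1).orthonormal.ne_zero a.2
    have hconj := hsym.conj_eigenvalue_eq_self
      (Module.End.hasEigenvalue_of_hasEigenvector ⟨(b a.1 a.2).2, hne⟩)
    rw [Complex.conj_eq_iff_re.1 hconj]
    exact hv
  obtain ⟨e, he⟩ : ∃ e : HilbertBasis (Σ μ, w μ) ℂ E, ∀ a, e a = (b a.1 a.2 : E) :=
    ⟨HilbertBasis.mkOfOrthogonalEqBot hon hbot,
      fun a => congrFun (HilbertBasis.coe_mkOfOrthogonalEqBot hon hbot) a⟩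
  exact ⟨Σ μ, w μ, e, fun a => a.1.re, fun a => by rw [he]; exact hdiag a⟩

end Hilbert

section FunctionalCalculus

variable {E : Type*} [NormedAddCommGroup E] [InnerProductSpace ℂ E]

theorem clm_mul_apply (A B : E →L[ℂ] E) (h : E) : (A * B) h = A (B h) := rfl

theorem tendsto_apply_of_norm_le {α : Type*} {l : Filter α} {A : α → E →L[ℂ] E} {A₀ : E →L[ℂ] E}
    {M : ℝ} (hM : ∀ a, ‖A a‖ ≤ M) (hA : ∀ h, Tendsto (fun a => A a h) l (𝓝 (A₀ h)))
    {z : α → E} {z₀ : E} (hz : Tendsto z l (𝓝 z₀)) :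
    Tendsto (fun a => A a (z a)) l (𝓝 (A₀ z₀)) := by
  have h1 : Tendsto (fun a => A a (z a - z₀)) l (𝓝 0) := by
    refine squeeze_zero_norm (fun a => (A a).le_of_opNorm_le (hM a) _) ?_
    simpa using ((hz.sub_const z₀).norm).const_mul M
  simpa using h1.add (hA z₀)

theorem algebraMap_real_apply (r : ℝ) (h : E) :
    algebraMap ℝ (E →L[ℂ] E) r h = (r : ℂ) • h := by
  rw [Algebra.algebraMap_eq_smul_one]; simp

theorem aeval_apply_eigenvector {A : E →L[ℂ] E} {v : E} {t : ℝ} (hv : A v = (t : ℂ) • v)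
    (q : Polynomial ℝ) : Polynomial.aeval A q v = ((q.eval t : ℝ) : ℂ) • v := by
  have hpow : ∀ n : ℕ, (A ^ n) v = ((t : ℂ) ^ n) • v := by
    intro n
    induction n with
    | zero => simp
    | succ n ih => rw [pow_succ', clm_mul_apply, ih, map_smul, hv, smul_smul, pow_succ]
  induction q using Polynomial.induction_on' with
  | add q r hq hr => simp [hq, hr, add_smul]
  | monomial n r =>
    rw [Polynomial.aeval_monomial, clm_mul_apply, algebraMap_real_apply, hpow, smul_smul]
    simp

theorem tendsto_aeval_apply {α : Type*} {l : Filter α} {A : α → E →L[ℂ] E} {A₀ : E →L[ℂ] E}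
    {M : ℝ} (hM : ∀ a, ‖A a‖ ≤ M) (hA : ∀ h, Tendsto (fun a => A a h) l (𝓝 (A₀ h)))
    (q : Polynomial ℝ) (h : E) :
    Tendsto (fun a => Polynomial.aeval (A a) q h) l (𝓝 (Polynomial.aeval A₀ q h)) := by
  induction q using Polynomial.induction_on' with
  | add q r hq hr => simpa using hq.add hr
  | monomial n r =>
    have hpow : ∀ n : ℕ, Tendsto (fun a => (A a ^ n) h) l (𝓝 ((A₀ ^ n) h)) := by
      intro n
      induction n with
      | zero => simpa using tendsto_const_nhds
      | succ n ih => simpa only [pow_succ', clm_mul_apply] using tendsto_apply_of_norm_le hM hA ih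
    simp only [Polynomial.aeval_monomial, clm_mul_apply, algebraMap_real_apply]
    exact (hpow n).const_smul _

variable [CompleteSpace E]

theorem exists_polynomial_norm_cfc_sub_aeval_le {φ : ℝ → ℝ} (hφ : Continuous φ) (M : ℝ)
    {ε : ℝ} (hε : 0 < ε) :
    ∃ q : Polynomial ℝ, (∀ t : ℝ, |t| ≤ M → |q.eval t - φ t| ≤ ε) ∧
      ∀ A : E →L[ℂ] E, IsSelfAdjoint A → ‖A‖ ≤ M →
        ‖cfc φ A - Polynomial.aeval A q‖ ≤ ε := by
  obtain ⟨q, hq⟩ := exists_polynomial_near_of_continuousOn (-M) M φ hφ.continuousOn ε hε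
  refine ⟨q, fun t ht => (hq t (abs_le.1 ht)).le, fun A hA hAM => ?_⟩
  rw [← cfc_polynomial q A, ← cfc_sub φ q.eval A]
  refine norm_cfc_le hε.le fun t ht => ?_
  have ht' : ‖t‖ ≤ M := by
    refine (spectrum.norm_le_norm_mul_of_mem ht).trans (le_trans ?_ hAM)
    exact mul_le_of_le_one_right (norm_nonneg _) ContinuousLinearMap.norm_id_le
  rw [norm_sub_rev]
  exact (hq t (abs_le.1 ht')).le

theorem cfc_apply_eigenvector {φ : ℝ → ℝ} (hφ : Continuous φ) {A : E →L[ℂ] E}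
    (hA : IsSelfAdjoint A) {v : E} {t : ℝ} (hv : A v = (t : ℂ) • v) :
    cfc φ A v = (φ t : ℂ) • v := by
  rcases eq_or_ne v 0 with rfl | hne
  · simp
  have ht : |t| ≤ ‖A‖ := by
    have h := A.le_opNorm v
    rw [hv, norm_smul, Complex.norm_real] at h
    exact le_of_mul_le_mul_right h (norm_pos_iff.2 hne)
  have key : ∀ ε > 0, ‖cfc φ A v - (φ t : ℂ) • v‖ ≤ ε * ‖v‖ + ε * ‖v‖ := by
    intro ε hε
    obtain ⟨q, hq1, hq2⟩ := exists_polynomial_norm_cfc_sub_aeval_le (E := E) hφ ‖A‖ hε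
    have e : cfc φ A v - (φ t : ℂ) • v =
        (cfc φ A - Polynomial.aeval A q) v + ((q.eval t - φ t : ℝ) : ℂ) • v := by
      rw [sub_apply, aeval_apply_eigenvector hv, Complex.ofReal_sub, sub_smul]
      abel
    rw [e]
    refine (norm_add_le _ _).trans (add_le_add ?_ ?_)
    · exact le_of_opNorm_le _ (hq2 A hA le_rfl) v
    · rw [norm_smul, Complex.norm_real]
      exact mul_le_mul_of_nonneg_right (hq1 t ht) (norm_nonneg _)
  rw [← sub_eq_zero, ← norm_le_zero_iff]
  refine le_of_forall_pos_le_add fun δ hδ => ?_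
  have hv0 := norm_pos_iff.2 hne
  refine (key (δ / (2 * ‖v‖)) (by positivity)).trans (le_of_eq ?_)
  field_simp
  ring

theorem tendsto_cfc_apply {φ : ℝ → ℝ} (hφ : Continuous φ) {α : Type*} {l : Filter α}
    {A : α → E →L[ℂ] E} {A₀ : E →L[ℂ] E} {M : ℝ} (hM : ∀ a, ‖A a‖ ≤ M) (hM₀ : ‖A₀‖ ≤ M)
    (hsa : ∀ a, IsSelfAdjoint (A a)) (hsa₀ : IsSelfAdjoint A₀)
    (hA : ∀ h, Tendsto (fun a => A a h) l (𝓝 (A₀ h))) (h : E) :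
    Tendsto (fun a => cfc φ (A a) h) l (𝓝 (cfc φ A₀ h)) := by
  refine Metric.tendsto_nhds.2 fun δ hδ => ?_
  set ε := δ / (3 * (‖h‖ + 1)) with hε_def
  have hε : 0 < ε := by positivity
  have hεh : ε * ‖h‖ ≤ δ / 3 := by
    rw [hε_def, div_mul_eq_mul_div, div_le_div_iff₀ (by positivity) (by norm_num)]
    nlinarith [norm_nonneg h]
  obtain ⟨q, -, hq⟩ := exists_polynomial_norm_cfc_sub_aeval_le (E := E) hφ M hε
  filter_upwards [Metric.tendsto_nhds.1 (tendsto_aeval_apply hM hA q h) (δ / 3) (by positivity)]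
    with a ha
  rw [dist_eq_norm] at ha ⊢
  have h1 := le_of_opNorm_le _ (hq (A a) (hsa a) (hM a)) h
  have h2 := le_of_opNorm_le _ (hq A₀ hsa₀ hM₀) h
  have e : cfc φ (A a) h - cfc φ A₀ h = (cfc φ (A a) - Polynomial.aeval (A a) q) h +
      (Polynomial.aeval (A a) q h - Polynomial.aeval A₀ q h) -
        (cfc φ A₀ - Polynomial.aeval A₀ q) h := by
    simp only [sub_apply]; abel
  rw [e]
  have := norm_sub_le ((cfc φ (A a) - Polynomial.aeval (A a) q) h +
    (Polynomial.aeval (A a) q h - Polynomial.aeval A₀ q h))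
      ((cfc φ A₀ - Polynomial.aeval A₀ q) h)
  have := norm_add_le ((cfc φ (A a) - Polynomial.aeval (A a) q) h)
    (Polynomial.aeval (A a) q h - Polynomial.aeval A₀ q h)
  linarith

end FunctionalCalculus

section Truncation

variable {E : Type*} [NormedAddCommGroup E] [InnerProductSpace ℂ E]

/-- The orthogonal projection onto the span of the first `m` vectors of a Hilbert basis. -/
def HilbertBasis.truncation (f : HilbertBasis ℕ ℂ E) (m : ℕ) : E →L[ℂ] E :=
  ∑ i ∈ Finset.range m, (innerSL ℂ (f i)).smulRight (f i)

namespace HilbertBasis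

variable (f : HilbertBasis ℕ ℂ E) (m : ℕ)

theorem truncation_apply (x : E) :
    f.truncation m x = ∑ i ∈ Finset.range m, inner ℂ (f i) x • f i := by
  simp [truncation]

theorem inner_truncation (k : ℕ) (x : E) :
    inner ℂ (f k) (f.truncation m x) = if k < m then inner ℂ (f k) x else 0 := by
  rw [truncation_apply, inner_sum]
  simp [inner_smul_right, orthonormal_iff_ite.1 f.orthonormal]

theorem inner_sub_truncation (k : ℕ) (x : E) :
    inner ℂ (f k) ((1 - f.truncation m) x) = if k < m then 0 else inner ℂ (f k) x := by
  rw [sub_apply, inner_sub_right, inner_truncation]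
  split_ifs <;> simp

theorem truncation_basis_of_le {k : ℕ} (hk : m ≤ k) : f.truncation m (f k) = 0 := by
  rw [truncation_apply]
  simp [orthonormal_iff_ite.1 f.orthonormal, hk]

theorem ext_inner {x y : E} (h : ∀ k, inner ℂ (f k) x = inner ℂ (f k) y) : x = y := by
  refine f.repr.injective ?_
  ext k
  rw [f.repr_apply_apply, f.repr_apply_apply, h]

theorem truncation_truncation (x : E) :
    f.truncation m (f.truncation m x) = f.truncation m x := by
  refine f.ext_inner fun k => ?_
  simp only [inner_truncation]
  split_ifs <;> rfl

theorem enorm_sub_truncation_sq (x : E) :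
    ‖(1 - f.truncation m) x‖ₑ ^ 2 = ∑' k, ‖inner ℂ (f (k + m)) x‖ₑ ^ 2 := by
  rw [← f.tsum_enorm_inner_sq, ← ENNReal.summable.sum_add_tsum_nat_add' (k := m)]
  simp only [inner_sub_truncation]
  rw [Finset.sum_eq_zero, zero_add]
  · simp
  · intro k hk
    simp [Finset.mem_range.1 hk]

theorem enorm_le_enorm {x y : E} (h : ∀ k, ‖inner ℂ (f k) x‖ₑ ≤ ‖inner ℂ (f k) y‖ₑ) :
    ‖x‖ₑ ≤ ‖y‖ₑ := by
  rw [← ENNReal.pow_le_pow_left_iff two_ne_zero, ← f.tsum_enorm_inner_sq x,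
    ← f.tsum_enorm_inner_sq y]
  exact ENNReal.tsum_le_tsum fun k => ENNReal.pow_le_pow_left (h k)

theorem norm_truncation_le : ‖f.truncation m‖ ≤ 1 := by
  refine opNorm_le_bound _ zero_le_one fun x => ?_
  rw [one_mul, ← enorm_le_iff_norm_le]
  refine f.enorm_le_enorm fun k => ?_
  rw [inner_truncation]
  split_ifs <;> simp

theorem norm_one_sub_truncation_le : ‖1 - f.truncation m‖ ≤ 1 := by
  refine opNorm_le_bound _ zero_le_one fun x => ?_
  rw [one_mul, ← enorm_le_iff_norm_le]
  refine f.enorm_le_enorm fun k => ?_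
  rw [inner_sub_truncation]
  split_ifs <;> simp

theorem tendsto_truncation_apply (x : E) :
    Tendsto (fun m => f.truncation m x) atTop (𝓝 x) := by
  simpa only [truncation_apply, f.repr_apply_apply] using (f.hasSum_repr x).tendsto_sum_nat

theorem isCompactOperator_truncation : IsCompactOperator (f.truncation m) := by
  refine (compactOperator (RingHom.id ℂ) E E).sum_mem fun i _ => ?_
  exact IsCompactOperator.clm_comp (f := innerSL ℂ (f i))
    (isCompactOperator_of_locallyCompactSpace_dom (innerSL ℂ (f i)))
    (toSpanSingleton ℂ (f i))

end HilbertBasis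

theorem enorm_sq_eq_ofReal_re_inner (x : E) :
    ‖x‖ₑ ^ 2 = ENNReal.ofReal (RCLike.re (inner ℂ x x)) := by
  rw [inner_self_eq_norm_sq (𝕜 := ℂ) x, ← ofReal_norm, ENNReal.ofReal_pow (norm_nonneg _)]

theorem enorm_inner_le (x y : E) : ‖inner ℂ x y‖ₑ ≤ ‖x‖ₑ * ‖y‖ₑ := by
  rw [← ofReal_norm, ← ofReal_norm, ← ofReal_norm, ← ENNReal.ofReal_mul (norm_nonneg _)]
  exact ENNReal.ofReal_le_ofReal (norm_inner_le_norm x y)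

theorem IsSelfAdjoint.inner_apply_eq [CompleteSpace E] {D : E →L[ℂ] E} (hD : IsSelfAdjoint D)
    (x y : E) : inner ℂ (D x) y = inner ℂ x (D y) :=
  hD.isSymmetric x y

namespace HilbertBasis

variable [CompleteSpace E] (f : HilbertBasis ℕ ℂ E) (m : ℕ)

theorem isSelfAdjoint_truncation : IsSelfAdjoint (f.truncation m) := by
  rw [isSelfAdjoint_iff_isSymmetric]
  intro x y
  simp only [coe_coe]
  rw [truncation_apply, truncation_apply, inner_sum, sum_inner]
  simp [inner_smul_left, inner_smul_right, mul_comm]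

theorem isSelfAdjoint_one_sub_truncation : IsSelfAdjoint (1 - f.truncation m) :=
  .sub (.one _) (f.isSelfAdjoint_truncation m)

/-- A self-adjoint Hilbert-Schmidt operator is compact. -/
theorem isCompactOperator_of_tsum_ne_top {D : E →L[ℂ] E} (hsa : IsSelfAdjoint D)
    (h : ∑' i, ‖D (f i)‖ₑ ^ 2 ≠ ⊤) : IsCompactOperator D := by
  have hsum : Tendsto (fun m => √(∑' k, ‖D (f (k + m))‖ₑ ^ 2).toReal) atTop (𝓝 0) := by
    have h1 := (ENNReal.tendsto_toReal ENNReal.zero_ne_top).comp (ENNReal.tendsto_sum_nat_add _ h)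
    simpa [Function.comp_def] using (Real.continuous_sqrt.tendsto _).comp h1
  have hfin : ∀ m, ∑' k, ‖D (f (k + m))‖ₑ ^ 2 ≠ ⊤ := fun m =>
    ne_top_of_le_ne_top h
      (ENNReal.tsum_comp_le_tsum_of_injective (add_left_injective m) fun i => ‖D (f i)‖ₑ ^ 2)
  have hlim : Tendsto (fun m => f.truncation m ∘L D) atTop (𝓝 D) := by
    rw [tendsto_iff_norm_sub_tendsto_zero]
    refine squeeze_zero (fun _ => norm_nonneg _) (fun m => ?_) hsum
    rw [norm_sub_rev]
    refine opNorm_le_bound _ (Real.sqrt_nonneg _) fun x => ?_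
    have e : (D - f.truncation m ∘L D) x = (1 - f.truncation m) (D x) := by simp
    have key : ‖(1 - f.truncation m) (D x)‖ₑ ^ 2 ≤ (∑' k, ‖D (f (k + m))‖ₑ ^ 2) * ‖x‖ₑ ^ 2 := by
      rw [enorm_sub_truncation_sq, ← ENNReal.tsum_mul_right]
      refine ENNReal.tsum_le_tsum fun k => ?_
      rw [← mul_pow]
      refine ENNReal.pow_le_pow_left ?_
      rw [← hsa.inner_apply_eq]
      exact enorm_inner_le _ _
    rw [e, ← Real.sqrt_sq (norm_nonneg x), ← Real.sqrt_mul ENNReal.toReal_nonneg]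
    refine Real.le_sqrt_of_sq_le ?_
    have h2 := ENNReal.toReal_mono (ENNReal.mul_ne_top (hfin m) (by simp)) key
    simpa using h2
  refine isCompactOperator_of_tendsto hlim (.of_forall fun m => ?_)
  exact (f.isCompactOperator_truncation m).comp_clm D

end HilbertBasis

end Truncation

section AbsPow

variable {E : Type*} [NormedAddCommGroup E] [InnerProductSpace ℂ E] [CompleteSpace E]

theorem isSelfAdjoint_adjoint_comp_self (T : E →L[ℂ] E) : IsSelfAdjoint (adjoint T ∘L T) :=
  (isPositive_adjoint_comp_self T).isSelfAdjoint

theorem nonneg_of_mem_spectrum_adjoint_comp_self (T : E →L[ℂ] E) {t : ℝ}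
    (ht : t ∈ spectrum ℝ (adjoint T ∘L T)) : 0 ≤ t :=
  spectrum_nonneg_of_nonneg ((nonneg_iff_isPositive _).2 (isPositive_adjoint_comp_self T)) ht

theorem absPow_eq_mul (T : E →L[ℂ] E) {p : ℝ} (hp : 0 < p) :
    absPow T p = cfc (fun t : ℝ => t ^ (p / 4)) (adjoint T ∘L T) *
      cfc (fun t : ℝ => t ^ (p / 4)) (adjoint T ∘L T) := by
  have hc : Continuous fun t : ℝ => t ^ (p / 4) := Real.continuous_rpow_const (by positivity)
  rw [← cfc_mul (fun t : ℝ => t ^ (p / 4)) (fun t : ℝ => t ^ (p / 4)) _ hc.continuousOn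
    hc.continuousOn, absPow]
  refine cfc_congr fun t ht => ?_
  have := nonneg_of_mem_spectrum_adjoint_comp_self T ht
  rw [← Real.rpow_add_of_nonneg this (by positivity) (by positivity)]
  ring_nf

theorem ofReal_re_inner_absPow (T : E →L[ℂ] E) {p : ℝ} (hp : 0 < p) (w : E) :
    ENNReal.ofReal (RCLike.re (inner ℂ w (absPow T p w))) =
      ‖cfc (fun t : ℝ => t ^ (p / 4)) (adjoint T ∘L T) w‖ₑ ^ 2 := by
  have hsa : IsSelfAdjoint (cfc (fun t : ℝ => t ^ (p / 4)) (adjoint T ∘L T)) := cfc_predicate _ _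
  rw [absPow_eq_mul T hp, clm_mul_apply, enorm_sq_eq_ofReal_re_inner]
  congr 2
  exact (hsa.inner_apply_eq _ _).symm

end AbsPow

section SVD

universe u

variable {E : Type u} [NormedAddCommGroup E] [InnerProductSpace ℂ E] [CompleteSpace E]

/-- `v`, `g`, `s` are the right singular vectors, the left singular vectors and the nonzero
singular values of `T`; the last two fields say that the system is complete. -/
structure IsSVD {κ : Type*} (T : E →L[ℂ] E) (p : ℝ) (v g : κ → E) (s : κ → ℝ) : Prop where
  orthonormal_right : Orthonormal ℂ v
  orthonormal_left : Orthonormal ℂ g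
  pos : ∀ j, 0 < s j
  apply_right : ∀ j, T (v j) = (s j : ℂ) • g j
  adjoint_comp_apply : ∀ j, (adjoint T ∘L T) (v j) = ((s j ^ 2 : ℝ) : ℂ) • v j
  enorm_inner_le : ∀ u x, ‖inner ℂ u (T x)‖ₑ ≤
    ∑' j, ‖s j‖ₑ * (‖inner ℂ (v j) x‖ₑ * ‖inner ℂ u (g j)‖ₑ)
  ofReal_re_inner : ∀ w, ENNReal.ofReal (RCLike.re (inner ℂ w (absPow T p w))) =
    ∑' j, ‖s j‖ₑ ^ p * ‖inner ℂ (v j) w‖ₑ ^ 2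

theorem exists_isSVD_of_eigenbasis {κ : Type*} {T : E →L[ℂ] E} {p : ℝ} (hp : 0 < p)
    (e : HilbertBasis κ ℂ E) {σ : κ → ℝ} (he : ∀ j, (adjoint T ∘L T) (e j) = (σ j : ℂ) • e j) :
    ∃ s : κ → ℝ, IsSVD T p (fun j : {j // s j ≠ 0} => e j)
      (fun j => ((s j)⁻¹ : ℂ) • T (e j)) (fun j => s j) := by
  have hTT : ∀ i j, inner ℂ (T (e i)) (T (e j)) = (σ j : ℂ) * inner ℂ (e i) (e j) := by
    intro i j
    rw [← inner_smul_right, ← he, comp_apply, adjoint_inner_right]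
  have hσ : ∀ j, ‖T (e j)‖ ^ 2 = σ j := by
    intro j
    have h1 : inner ℂ (e j) (e j) = 1 := by simp [inner_self_eq_norm_sq_to_K, e.orthonormal.1 j]
    have := hTT j j
    rw [h1, mul_one, inner_self_eq_norm_sq_to_K] at this
    exact Complex.ofReal_injective (by simpa using this)
  have h0 : ∀ j, ‖T (e j)‖ = 0 → T (e j) = 0 := fun j h => norm_eq_zero.1 h
  refine ⟨fun j => ‖T (e j)‖, ?_, ?_, ?_, ?_, ?_, ?_, ?_⟩
  · exact e.orthonormal.comp _ Subtype.val_injective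
  · refine ⟨fun j => ?_, fun i j hij => ?_⟩
    · have hj : ‖T (e j)‖ ≠ 0 := j.2
      simp [norm_smul, hj]
    · simp only [inner_smul_left, inner_smul_right]
      rw [hTT, e.orthonormal.2 (Subtype.coe_injective.ne hij)]
      simp
  · intro j
    exact lt_of_le_of_ne (norm_nonneg _) (Ne.symm j.2)
  · intro j
    rw [smul_smul, mul_inv_cancel₀ (by exact_mod_cast j.2), one_smul]
  · intro j
    rw [he, hσ]
  · intro u x
    have h1 := (e.hasSum_inner_mul_inner (adjoint T u) x).tsum_eq
    rw [adjoint_inner_left] at h1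
    rw [← h1]
    refine enorm_tsum_le_tsum_enorm.trans ?_
    rw [← tsum_subtype_eq_of_support_subset (s := {j | ‖T (e j)‖ ≠ 0})]
    · refine ENNReal.tsum_le_tsum fun j => le_of_eq ?_
      have hj : (‖T (e j)‖ : ℂ) ≠ 0 := Complex.ofReal_ne_zero.2 j.2
      have h2 : T (e j) = (‖T (e j)‖ : ℂ) • ((‖T (e j)‖ : ℂ)⁻¹ • T (e j)) := by
        rw [smul_smul, mul_inv_cancel₀ hj, one_smul]
      rw [adjoint_inner_left]
      conv_lhs => rw [h2]
      rw [inner_smul_right, enorm_mul, enorm_mul, mul_assoc, mul_comm ‖inner ℂ u _‖ₑ]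
      congr 1
      simp [← ofReal_norm]
    · intro j hj h
      simp only [adjoint_inner_left, Function.mem_support] at hj
      exact hj (by simp [h0 j h])
  · intro w
    have hc : Continuous fun t : ℝ => t ^ (p / 4) := Real.continuous_rpow_const (by positivity)
    have hsa : IsSelfAdjoint (cfc (fun t : ℝ => t ^ (p / 4)) (adjoint T ∘L T)) := cfc_predicate _ _
    have hterm : ∀ j, ‖inner ℂ (e j) (cfc (fun t : ℝ => t ^ (p / 4)) (adjoint T ∘L T) w)‖ₑ ^ 2 =
        ‖‖T (e j)‖‖ₑ ^ p * ‖inner ℂ (e j) w‖ₑ ^ 2 := by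
      intro j
      rw [← hsa.inner_apply_eq,
        cfc_apply_eigenvector hc (isSelfAdjoint_adjoint_comp_self T) (he j), inner_smul_left,
        enorm_mul, mul_pow, ← hσ]
      congr 1
      rw [Complex.conj_ofReal, ← ofReal_norm, Complex.norm_real, ofReal_norm, ← enorm_pow,
        ← Real.enorm_rpow_of_nonneg (norm_nonneg _) hp.le, ← Real.rpow_natCast, ← Real.rpow_natCast,
        ← Real.rpow_mul (norm_nonneg _), ← Real.rpow_mul (norm_nonneg _)]
      congr 2
      push_cast
      ring
    rw [ofReal_re_inner_absPow T hp, ← e.tsum_enorm_inner_sq]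
    simp_rw [hterm]
    rw [← tsum_subtype_eq_of_support_subset (s := {j | ‖T (e j)‖ ≠ 0})]
    · rfl
    · intro j hj h
      exact hj (by simp [show ‖T (e j)‖ = 0 from h, ENNReal.zero_rpow_of_pos hp])

theorem exists_isSVD (f : HilbertBasis ℕ ℂ E) {T : E →L[ℂ] E} {p : ℝ} (hp : 0 < p)
    (hfin : trAbsPow f T p ≠ ⊤) :
    ∃ (κ : Type u) (v g : κ → E) (s : κ → ℝ), IsSVD T p v g s := by
  set D : E →L[ℂ] E := cfc (fun t : ℝ => t ^ (p / 4)) (adjoint T ∘L T) with hD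
  have hsa : IsSelfAdjoint D := cfc_predicate _ _
  have hcomp : IsCompactOperator D := by
    refine f.isCompactOperator_of_tsum_ne_top hsa ?_
    simpa only [trAbsPow, posTr, ofReal_re_inner_absPow T hp] using hfin
  obtain ⟨κ, e, d, hd⟩ := hcomp.exists_hilbertBasis_eigenvectors hsa
  have hc : Continuous fun t : ℝ => t ^ (p / 4) := Real.continuous_rpow_const (by positivity)
  have hc' : Continuous fun t : ℝ => t ^ (4 / p) := Real.continuous_rpow_const (by positivity)
  have hA : cfc (fun t : ℝ => t ^ (4 / p)) D = adjoint T ∘L T := by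
    have hT := isSelfAdjoint_adjoint_comp_self T
    rw [hD, ← cfc_comp' (fun t : ℝ => t ^ (4 / p)) (fun t : ℝ => t ^ (p / 4)) _
      hc'.continuousOn hc.continuousOn]
    conv_rhs => rw [← cfc_id' ℝ (adjoint T ∘L T)]
    refine cfc_congr fun t ht => ?_
    have := nonneg_of_mem_spectrum_adjoint_comp_self T ht
    rw [← Real.rpow_mul this]
    have : p / 4 * (4 / p) = 1 := by field_simp
    rw [this, Real.rpow_one]
  obtain ⟨s, hs⟩ := exists_isSVD_of_eigenbasis (T := T) hp e (σ := fun j => d j ^ (4 / p))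
    fun j => by rw [← hA]; exact cfc_apply_eigenvector hc' hsa (hd j)
  exact ⟨_, _, _, _, hs⟩

end SVD

section SchattenNorm

universe u

variable {E : Type u} [NormedAddCommGroup E] [InnerProductSpace ℂ E]

theorem Orthonormal.tsum_enorm_inner_mul_le {ι : Type*} {u w : ι → E} (hu : Orthonormal ℂ u)
    (hw : Orthonormal ℂ w) (x y : E) :
    ∑' i, ‖inner ℂ (u i) x‖ₑ * ‖inner ℂ (w i) y‖ₑ ≤ ‖x‖ₑ * ‖y‖ₑ := by
  have h : ∀ z : ENNReal, (z ^ 2) ^ (1 / 2 : ℝ) = z := fun z => by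
    rw [← ENNReal.rpow_natCast, ← ENNReal.rpow_mul]
    norm_num
  refine (ENNReal.tsum_mul_le_sqrt_mul_sqrt _ _).trans ?_
  rw [← h ‖x‖ₑ, ← h ‖y‖ₑ]
  gcongr
  · exact hu.tsum_enorm_inner_sq_le x
  · exact hw.tsum_enorm_inner_sq_le y

theorem enorm_apply_le_of_norm_le_one {R : E →L[ℂ] E} (hR : ‖R‖ ≤ 1) (x : E) : ‖R x‖ₑ ≤ ‖x‖ₑ :=
  enorm_le_iff_norm_le.2 (by simpa using R.le_of_opNorm_le hR x)

variable [CompleteSpace E] {κ : Type*} {T : E →L[ℂ] E} {p : ℝ} {v g : κ → E} {s : κ → ℝ}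

namespace IsSVD

theorem trAbsPow_eq (h : IsSVD T p v g s) (f : HilbertBasis ℕ ℂ E) :
    trAbsPow f T p = ∑' j, ‖s j‖ₑ ^ p := by
  simp only [trAbsPow, posTr, h.ofReal_re_inner]
  rw [ENNReal.tsum_comm]
  refine tsum_congr fun j => ?_
  simp_rw [enorm_inner_comm (v j)]
  rw [ENNReal.tsum_mul_left, f.tsum_enorm_inner_sq, h.orthonormal_right.enorm_eq_one]
  simp

theorem enorm_inner_apply (h : IsSVD T p v g s) (j : κ) :
    ‖inner ℂ (g j) (T (v j))‖ₑ = ‖s j‖ₑ := by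
  rw [h.apply_right, inner_smul_right, inner_self_eq_norm_sq_to_K, h.orthonormal_left.1]
  simp [← ofReal_norm]

theorem tsum_enorm_inner_rpow_le (h : IsSVD T p v g s) (hp : 1 ≤ p) {R : E →L[ℂ] E}
    (hR : IsSelfAdjoint R) (hR1 : ‖R‖ ≤ 1) {ι : Type*} {u w : ι → E} (hu : Orthonormal ℂ u)
    (hw : Orthonormal ℂ w) :
    ∑' i, ‖inner ℂ (u i) (T (R (w i)))‖ₑ ^ p ≤ ∑' j, ‖s j‖ₑ ^ p * ‖R (v j)‖ₑ := by
  have hp0 : 0 ≤ p := by linarith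
  have h1 : ∀ i, ‖inner ℂ (u i) (T (R (w i)))‖ₑ ^ p ≤
      ∑' j, (‖inner ℂ (v j) (R (w i))‖ₑ * ‖inner ℂ (g j) (u i)‖ₑ) * ‖s j‖ₑ ^ p := by
    intro i
    refine (ENNReal.rpow_le_rpow (h.enorm_inner_le _ _) hp0).trans ?_
    simp_rw [enorm_inner_comm (u i), mul_comm ‖s _‖ₑ]
    refine ENNReal.tsum_mul_rpow_le hp _ _ ?_
    refine (h.orthonormal_right.tsum_enorm_inner_mul_le h.orthonormal_left _ _).trans ?_
    rw [hu.enorm_eq_one, mul_one, ← hw.enorm_eq_one i]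
    exact enorm_apply_le_of_norm_le_one hR1 _
  refine (ENNReal.tsum_le_tsum h1).trans ?_
  rw [ENNReal.tsum_comm]
  refine ENNReal.tsum_le_tsum fun j => ?_
  rw [ENNReal.tsum_mul_right, mul_comm]
  gcongr
  simp_rw [← hR.inner_apply_eq, enorm_inner_comm (R (v j)), enorm_inner_comm (g j)]
  refine (hw.tsum_enorm_inner_mul_le hu _ _).trans ?_
  rw [h.orthonormal_left.enorm_eq_one, mul_one]

end IsSVD

theorem tendsto_ofReal_re_inner_absPow {α : Type*} {l : Filter α} {A : α → E →L[ℂ] E}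
    {A₀ : E →L[ℂ] E} {C p : ℝ} (hp : 0 < p) (hC : ∀ a, ‖A a‖ ≤ C) (hC₀ : ‖A₀‖ ≤ C)
    (hA : ∀ h, Tendsto (fun a => A a h) l (𝓝 (A₀ h)))
    (hA' : ∀ h, Tendsto (fun a => adjoint (A a) h) l (𝓝 (adjoint A₀ h))) (w : E) :
    Tendsto (fun a => ENNReal.ofReal (RCLike.re (inner ℂ w (absPow (A a) p w)))) l
      (𝓝 (ENNReal.ofReal (RCLike.re (inner ℂ w (absPow A₀ p w))))) := by
  have hc : Continuous fun t : ℝ => t ^ (p / 2) := Real.continuous_rpow_const (by positivity)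
  have hadj : ∀ B : E →L[ℂ] E, ‖adjoint B‖ = ‖B‖ := fun B => LinearIsometryEquiv.norm_map _ B
  have hM : ∀ B : E →L[ℂ] E, ‖B‖ ≤ C → ‖adjoint B ∘L B‖ ≤ C * C := fun B hB => by
    refine (opNorm_comp_le _ _).trans ?_
    rw [hadj]
    exact mul_le_mul hB hB (norm_nonneg _) ((norm_nonneg _).trans hB)
  refine ENNReal.tendsto_ofReal ((RCLike.continuous_re.tendsto _).comp
    (tendsto_const_nhds.inner (tendsto_cfc_apply hc (fun a => hM _ (hC a)) (hM _ hC₀)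
      (fun a => isSelfAdjoint_adjoint_comp_self _) (isSelfAdjoint_adjoint_comp_self _)
      (fun h => ?_) w)))
  exact tendsto_apply_of_norm_le (fun a => (hadj _).trans_le (hC a)) hA' (hA h)

theorem trAbsPow_comp_truncation (f : HilbertBasis ℕ ℂ E) (S : E →L[ℂ] E) {p : ℝ} (hp : 0 < p)
    (m : ℕ) : trAbsPow f (S ∘L f.truncation m) p =
      ∑ i ∈ Finset.range m,
        ENNReal.ofReal (RCLike.re (inner ℂ (f i) (absPow (S ∘L f.truncation m) p (f i)))) := by
  rw [trAbsPow, posTr]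
  refine tsum_eq_sum fun i hi => ?_
  have hc : Continuous fun t : ℝ => t ^ (p / 2) := Real.continuous_rpow_const (by positivity)
  have h0 : (adjoint (S ∘L f.truncation m) ∘L (S ∘L f.truncation m)) (f i) =
      ((0 : ℝ) : ℂ) • f i := by
    simp [f.truncation_basis_of_le m (by simpa using hi)]
  rw [absPow, cfc_apply_eigenvector hc (isSelfAdjoint_adjoint_comp_self _) h0,
    Real.zero_rpow (by positivity)]
  simp

theorem adjoint_comp_truncation (f : HilbertBasis ℕ ℂ E) (S : E →L[ℂ] E) (m : ℕ) :
    adjoint (S ∘L f.truncation m) = f.truncation m ∘L adjoint S := by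
  rw [adjoint_comp, (f.isSelfAdjoint_truncation m).adjoint_eq]

/-- The variational bound for `tr |S|^p`. -/
theorem trAbsPow_le_of_forall_orthonormal (f : HilbertBasis ℕ ℂ E) (S : E →L[ℂ] E) {p : ℝ}
    (hp : 0 < p) {c : ENNReal}
    (h : ∀ (ι : Type u) (u w : ι → E), Orthonormal ℂ u → Orthonormal ℂ w →
      ∑' i, ‖inner ℂ (u i) (S (w i))‖ₑ ^ p ≤ c) : trAbsPow f S p ≤ c := by
  have hfin : ∀ m, trAbsPow f (S ∘L f.truncation m) p ≠ ⊤ := fun m => by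
    rw [trAbsPow_comp_truncation f S hp m]
    exact ENNReal.sum_ne_top.2 fun i _ => ENNReal.ofReal_ne_top
  have htrunc : ∀ m, trAbsPow f (S ∘L f.truncation m) p ≤ c := by
    intro m
    obtain ⟨κ, v, g, s, hs⟩ := exists_isSVD f hp (hfin m)
    rw [hs.trAbsPow_eq f]
    have hv : ∀ j, f.truncation m (v j) = v j := by
      intro j
      have h1 := hs.adjoint_comp_apply j
      have h2 : ((s j ^ 2 : ℝ) : ℂ) ≠ 0 :=
        Complex.ofReal_ne_zero.2 (pow_ne_zero _ (hs.pos j).ne')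
      rw [adjoint_comp_truncation] at h1
      rw [← inv_smul_smul₀ h2 (v j), ← h1, map_smul]
      congr 1
      exact f.truncation_truncation m _
    refine le_trans (le_of_eq (tsum_congr fun j => ?_))
      (h κ g v hs.orthonormal_left hs.orthonormal_right)
    rw [← hs.enorm_inner_apply j, comp_apply, hv]
  have hnorm : ∀ m, ‖S ∘L f.truncation m‖ ≤ ‖S‖ := fun m =>
    (opNorm_comp_le _ _).trans
      (mul_le_of_le_one_right (norm_nonneg _) (f.norm_truncation_le m))
  refine ENNReal.tsum_le_of_sum_range_le fun n => ?_
  refine le_of_tendsto' (tendsto_finsetSum _ fun i _ => tendsto_ofReal_re_inner_absPow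
    (A := fun m => S ∘L f.truncation m) (l := atTop) hp hnorm le_rfl ?_ ?_ (f i)) fun m => ?_
  · exact fun x => (S.continuous.tendsto _).comp (f.tendsto_truncation_apply x)
  · intro x
    simp_rw [adjoint_comp_truncation]
    exact f.tendsto_truncation_apply _
  · exact (ENNReal.sum_le_tsum _).trans (htrunc m)

theorem tsum_enorm_inner_rpow_le_trAbsPow (f : HilbertBasis ℕ ℂ E) {S : E →L[ℂ] E} {p : ℝ}
    (hp : 1 ≤ p) {ι : Type*} {u w : ι → E} (hu : Orthonormal ℂ u) (hw : Orthonormal ℂ w) :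
    ∑' i, ‖inner ℂ (u i) (S (w i))‖ₑ ^ p ≤ trAbsPow f S p := by
  by_cases hfin : trAbsPow f S p = ⊤
  · simp [hfin]
  obtain ⟨κ, v, g, s, hs⟩ := exists_isSVD f (by linarith) hfin
  rw [hs.trAbsPow_eq f]
  refine (hs.tsum_enorm_inner_rpow_le hp (R := 1) (.one _) norm_id_le hu hw).trans ?_
  refine ENNReal.tsum_le_tsum fun j => ?_
  rw [show (1 : E →L[ℂ] E) (v j) = v j from rfl, hs.orthonormal_right.enorm_eq_one, mul_one]

/-- Minkowski's inequality for the Schatten norms. -/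
theorem trAbsPow_add_le (f : HilbertBasis ℕ ℂ E) (A B : E →L[ℂ] E) {p : ℝ} (hp : 1 ≤ p) :
    trAbsPow f (A + B) p ≤
      (trAbsPow f A p ^ (1 / p) + trAbsPow f B p ^ (1 / p)) ^ p := by
  have hp0 : 0 < p := by linarith
  refine trAbsPow_le_of_forall_orthonormal f _ hp0 fun ι u w hu hw => ?_
  calc ∑' i, ‖inner ℂ (u i) ((A + B) (w i))‖ₑ ^ p
      ≤ ∑' i, (‖inner ℂ (u i) (A (w i))‖ₑ + ‖inner ℂ (u i) (B (w i))‖ₑ) ^ p := by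
        refine ENNReal.tsum_le_tsum fun i => ENNReal.rpow_le_rpow ?_ hp0.le
        rw [add_apply, inner_add_right]
        exact enorm_add_le _ _
    _ ≤ _ := ENNReal.tsum_Lp_add_le hp _ _
    _ ≤ _ := by
        gcongr
        · exact tsum_enorm_inner_rpow_le_trAbsPow f hp hu hw
        · exact tsum_enorm_inner_rpow_le_trAbsPow f hp hu hw

theorem trAbsPow_comp_one_sub_truncation_le (f : HilbertBasis ℕ ℂ E) {T : E →L[ℂ] E} {p : ℝ}
    (hp : 1 ≤ p) (hfin : trAbsPow f T p ≠ ⊤) (m : ℕ) :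
    trAbsPow f (T ∘L (1 - f.truncation m)) p ≤ trAbsPow f T p ^ (1 / 2 : ℝ) *
      (∑' k, ENNReal.ofReal (RCLike.re (inner ℂ (f (k + m)) (absPow T p (f (k + m)))))) ^
        (1 / 2 : ℝ) := by
  have hp0 : 0 < p := by linarith
  obtain ⟨κ, v, g, s, hs⟩ := exists_isSVD f hp0 hfin
  have hsq : ∀ j, ‖s j‖ₑ ^ p = (‖s j‖ₑ ^ (p / 2)) ^ 2 := fun j => by
    rw [← ENNReal.rpow_natCast, ← ENNReal.rpow_mul]
    norm_num
  refine trAbsPow_le_of_forall_orthonormal f _ hp0 fun ι u w hu hw => ?_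
  refine (hs.tsum_enorm_inner_rpow_le hp (f.isSelfAdjoint_one_sub_truncation m)
    (f.norm_one_sub_truncation_le m) hu hw).trans ?_
  have htail : ∑' k, ENNReal.ofReal (RCLike.re (inner ℂ (f (k + m)) (absPow T p (f (k + m))))) =
      ∑' j, (‖s j‖ₑ ^ (p / 2) * ‖(1 - f.truncation m) (v j)‖ₑ) ^ 2 := by
    simp_rw [hs.ofReal_re_inner, mul_pow, f.enorm_sub_truncation_sq, ← hsq, enorm_inner_comm (v _)]
    rw [ENNReal.tsum_comm]
    exact tsum_congr fun j => ENNReal.tsum_mul_left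
  rw [htail, hs.trAbsPow_eq f]
  simp_rw [hsq, pow_two (‖s _‖ₑ ^ (p / 2)), mul_assoc, ← pow_two (‖s _‖ₑ ^ (p / 2))]
  exact ENNReal.tsum_mul_le_sqrt_mul_sqrt _ _

end SchattenNorm

section SchattenTopology

variable {E : Type*} [NormedAddCommGroup E] [InnerProductSpace ℂ E] [CompleteSpace E]
  (f : HilbertBasis ℕ ℂ E) {p : ℝ}

theorem trAbsPow_neg (A : E →L[ℂ] E) : trAbsPow f (-A) p = trAbsPow f A p := by
  simp [trAbsPow, absPow]

theorem trAbsPow_rpow_add_le (hp : 1 ≤ p) (A B : E →L[ℂ] E) :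
    trAbsPow f (A + B) p ^ (1 / p) ≤ trAbsPow f A p ^ (1 / p) + trAbsPow f B p ^ (1 / p) := by
  rw [one_div, ENNReal.rpow_inv_le_iff (by linarith), ← one_div]
  exact trAbsPow_add_le f A B hp

theorem trAbsPow_rpow_sub_le (hp : 1 ≤ p) (A B : E →L[ℂ] E) :
    trAbsPow f (A - B) p ^ (1 / p) ≤ trAbsPow f A p ^ (1 / p) + trAbsPow f B p ^ (1 / p) := by
  rw [sub_eq_add_neg]
  simpa only [trAbsPow_neg] using trAbsPow_rpow_add_le f hp A (-B)

theorem sNorm_eq_toReal (A : E →L[ℂ] E) :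
    sNorm f p A = (trAbsPow f A p ^ (1 / p)).toReal := by
  rw [sNorm, ENNReal.toReal_rpow]

theorem sNorm_rpow (hp : 1 ≤ p) (A : E →L[ℂ] E) :
    sNorm f p A ^ p = (trAbsPow f A p).toReal := by
  rw [sNorm, ← Real.rpow_mul ENNReal.toReal_nonneg, one_div_mul_cancel (by linarith), Real.rpow_one]

theorem sNorm_neg (A : E →L[ℂ] E) : sNorm f p (-A) = sNorm f p A := by
  rw [sNorm, trAbsPow_neg, sNorm]

theorem trAbsPow_sub_ne_top (hp : 1 ≤ p) {A B : E →L[ℂ] E} (hA : trAbsPow f A p ≠ ⊤)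
    (hB : trAbsPow f B p ≠ ⊤) : trAbsPow f (A - B) p ≠ ⊤ := by
  have hp' : 0 < 1 / p := one_div_pos.2 (by linarith)
  intro h
  have := trAbsPow_rpow_sub_le f hp A B
  rw [h, ENNReal.top_rpow_of_pos hp', top_le_iff] at this
  exact ENNReal.add_ne_top.2
    ⟨ENNReal.rpow_ne_top_of_nonneg hp'.le hA, ENNReal.rpow_ne_top_of_nonneg hp'.le hB⟩ this

theorem sNorm_add_le (hp : 1 ≤ p) {A B : E →L[ℂ] E} (hA : trAbsPow f A p ≠ ⊤)
    (hB : trAbsPow f B p ≠ ⊤) : sNorm f p (A + B) ≤ sNorm f p A + sNorm f p B := by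
  have hp' : 0 ≤ 1 / p := one_div_nonneg.2 (by linarith)
  have hA' := ENNReal.rpow_ne_top_of_nonneg hp' hA
  have hB' := ENNReal.rpow_ne_top_of_nonneg hp' hB
  rw [sNorm_eq_toReal, sNorm_eq_toReal, sNorm_eq_toReal, ← ENNReal.toReal_add hA' hB']
  exact ENNReal.toReal_mono (ENNReal.add_ne_top.2 ⟨hA', hB'⟩) (trAbsPow_rpow_add_le f hp A B)

theorem abs_sNorm_sub_sNorm_le (hp : 1 ≤ p) {A B : E →L[ℂ] E} (hA : trAbsPow f A p ≠ ⊤)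
    (hB : trAbsPow f B p ≠ ⊤) : |sNorm f p A - sNorm f p B| ≤ sNorm f p (A - B) := by
  have h1 := sNorm_add_le f hp (trAbsPow_sub_ne_top f hp hA hB) hB
  have h2 := sNorm_add_le f hp (trAbsPow_sub_ne_top f hp hB hA) hA
  rw [sub_add_cancel] at h1 h2
  rw [← neg_sub, sNorm_neg] at h2
  rw [abs_le]
  constructor <;> linarith

/-- For bounded *-strongly convergent operators, convergence of `tr |·|^p` to a finite limit
implies convergence in the Schatten norm. -/
theorem tendsto_trAbsPow_sub_rpow (hp : 1 ≤ p) {α : Type*} {l : Filter α} {A : α → E →L[ℂ] E}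
    {A₀ : E →L[ℂ] E} {C : ℝ} (hC : ∀ a, ‖A a‖ ≤ C) (hC₀ : ‖A₀‖ ≤ C)
    (hA : ∀ h, Tendsto (fun a => A a h) l (𝓝 (A₀ h)))
    (hA' : ∀ h, Tendsto (fun a => adjoint (A a) h) l (𝓝 (adjoint A₀ h)))
    (hfin : ∀ a, trAbsPow f (A a) p ≠ ⊤) (hfin₀ : trAbsPow f A₀ p ≠ ⊤)
    (htr : Tendsto (fun a => trAbsPow f (A a) p) l (𝓝 (trAbsPow f A₀ p))) :
    Tendsto (fun a => trAbsPow f (A a - A₀) p ^ (1 / p)) l (𝓝 0) := by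
  have hp0 : 0 < p := by linarith
  have hp' : 0 < 1 / p := one_div_pos.2 hp0
  let d : (E →L[ℂ] E) → ℕ → ENNReal := fun B i =>
    ENNReal.ofReal (RCLike.re (inner ℂ (f i) (absPow B p (f i))))
  let tail : (E →L[ℂ] E) → ℕ → ENNReal := fun B m => ∑' k, d B (k + m)
  have hd : ∀ i, Tendsto (fun a => d (A a) i) l (𝓝 (d A₀ i)) := fun i =>
    tendsto_ofReal_re_inner_absPow hp0 hC hC₀ hA hA' (f i)
  have htail_eq : ∀ B m, tail B m = trAbsPow f B p - ∑ i ∈ Finset.range m, d B i := by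
    intro B m
    refine ENNReal.eq_sub_of_add_eq (ENNReal.sum_ne_top.2 fun i _ => ENNReal.ofReal_ne_top) ?_
    rw [add_comm]
    exact ENNReal.summable.sum_add_tsum_nat_add' (f := d B)
  have htail_ne : ∀ B m, trAbsPow f B p ≠ ⊤ → tail B m ≠ ⊤ := fun B m hB => by
    rw [htail_eq]
    exact ENNReal.sub_ne_top hB
  have htail : ∀ m, Tendsto (fun a => tail (A a) m) l (𝓝 (tail A₀ m)) := by
    intro m
    simp_rw [htail_eq]
    exact ENNReal.Tendsto.sub htr (tendsto_finsetSum _ fun i _ => hd i) (.inl hfin₀)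
  have htail₀ : Tendsto (fun m => tail A₀ m) atTop (𝓝 0) :=
    ENNReal.tendsto_sum_nat_add (d A₀) hfin₀
  let r : (E →L[ℂ] E) → ℕ → ENNReal := fun B m =>
    (trAbsPow f B p ^ (1 / 2 : ℝ) * tail B m ^ (1 / 2 : ℝ)) ^ (1 / p)
  have hhalf : ∀ z : ENNReal, z ≠ ⊤ → z ^ (1 / 2 : ℝ) ≠ ⊤ := fun z hz =>
    ENNReal.rpow_ne_top_of_nonneg (by norm_num) hz
  have hr : ∀ m, Tendsto (fun a => r (A a) m) l (𝓝 (r A₀ m)) := fun m =>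
    (ENNReal.Tendsto.mul (htr.ennrpow_const _) (.inr (hhalf _ (htail_ne _ _ hfin₀)))
      ((htail m).ennrpow_const _) (.inr (hhalf _ hfin₀))).ennrpow_const _
  have hr₀ : Tendsto (fun m => r A₀ m) atTop (𝓝 0) := by
    have := (ENNReal.Tendsto.const_mul (a := trAbsPow f A₀ p ^ (1 / 2 : ℝ))
      (htail₀.ennrpow_const (1 / 2 : ℝ)) (.inr (hhalf _ hfin₀))).ennrpow_const (1 / p)
    rwa [ENNReal.zero_rpow_of_pos (by norm_num), mul_zero, ENNReal.zero_rpow_of_pos hp'] at this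
  have htrunc : ∀ m, Tendsto
      (fun a => trAbsPow f ((A a - A₀) ∘L f.truncation m) p ^ (1 / p)) l (𝓝 0) := by
    intro m
    have h0 : ∀ w : E, ENNReal.ofReal (RCLike.re (inner ℂ w (absPow (0 : E →L[ℂ] E) p w))) = 0 := by
      intro w
      rw [ofReal_re_inner_absPow _ hp0]
      have hc : Continuous fun t : ℝ => t ^ (p / 4) := Real.continuous_rpow_const (by positivity)
      rw [cfc_apply_eigenvector (t := 0) hc (isSelfAdjoint_adjoint_comp_self _) (by simp),
        Real.zero_rpow (by positivity)]
      simp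
    have h1 : Tendsto (fun a => trAbsPow f ((A a - A₀) ∘L f.truncation m) p) l (𝓝 0) := by
      simp_rw [trAbsPow_comp_truncation f _ hp0 m]
      rw [← Finset.sum_const_zero (s := Finset.range m)]
      refine tendsto_finsetSum _ fun i _ => ?_
      rw [← h0 (f i)]
      refine tendsto_ofReal_re_inner_absPow (C := C + C) hp0 (fun a => ?_) ?_ (fun h => ?_)
        (fun h => ?_) (f i)
      · refine (opNorm_comp_le _ _).trans
          ((mul_le_of_le_one_right (norm_nonneg _) (f.norm_truncation_le m)).trans ?_)
        exact (norm_sub_le _ _).trans (add_le_add (hC a) hC₀)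
      · have := (norm_nonneg _).trans hC₀
        simpa using this
      · simpa using (hA (f.truncation m h)).sub_const (A₀ (f.truncation m h))
      · simp_rw [adjoint_comp_truncation, map_sub]
        have := (hA' h).sub_const (adjoint A₀ h)
        rw [sub_self] at this
        simpa [Function.comp_def] using ((f.truncation m).continuous.tendsto 0).comp this
    simpa [ENNReal.zero_rpow_of_pos, hp0] using h1.ennrpow_const (1 / p)
  have hbound : ∀ a m, trAbsPow f (A a - A₀) p ^ (1 / p) ≤
      trAbsPow f ((A a - A₀) ∘L f.truncation m) p ^ (1 / p) + (r (A a) m + r A₀ m) := by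
    intro a m
    have e : A a - A₀ = (A a - A₀) ∘L f.truncation m +
        (A a ∘L (1 - f.truncation m) - A₀ ∘L (1 - f.truncation m)) := by
      ext h
      simp
      abel
    conv_lhs => rw [e]
    refine (trAbsPow_rpow_add_le f hp _ _).trans (add_le_add le_rfl ?_)
    refine (trAbsPow_rpow_sub_le f hp _ _).trans (add_le_add ?_ ?_)
    · exact ENNReal.rpow_le_rpow (trAbsPow_comp_one_sub_truncation_le f hp (hfin a) m) hp'.le
    · exact ENNReal.rpow_le_rpow (trAbsPow_comp_one_sub_truncation_le f hp hfin₀ m) hp'.le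
  rw [ENNReal.tendsto_nhds_zero]
  intro ε hε
  have hlim : Tendsto (fun m => 0 + (r A₀ m + r A₀ m)) atTop (𝓝 0) := by
    simpa using (hr₀.add hr₀).const_add 0
  obtain ⟨m, hm⟩ := (hlim.eventually (gt_mem_nhds hε)).exists
  filter_upwards [((htrunc m).add ((hr m).add_const (r A₀ m))).eventually (gt_mem_nhds hm)]
    with a ha
  exact (hbound a m).trans ha.le

end SchattenTopology

/-- for a bounded *-strongly continuous `T : X → B(H)`, the condition
"`T(x) ∈ S_p(H)` for all `x` and `x ↦ tr|T(x)|^p ∈ C₀(X)`" is equivalent to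
`T ∈ C₀(X, S_p(H))`. -/
theorem c0Schatten_iff_pointwise_trace_c0 {X : Type*} [TopologicalSpace X]
    [LocallyCompactSpace X] [T2Space X]
    (f : HilbertBasis ℕ ℂ H) (p : ℝ) (hp : 1 ≤ p)
    (T : X → H →L[ℂ] H) (C : ℝ) (hbound : ∀ x, ‖T x‖ ≤ C)
    (hstrong : ∀ h : H, Continuous (fun x => T x h) ∧
      Continuous (fun x => ContinuousLinearMap.adjoint (T x) h)) :
    ((∀ x, trAbsPow f (T x) p ≠ ⊤) ∧
      Continuous (fun x => (trAbsPow f (T x) p).toReal) ∧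
      Tendsto (fun x => (trAbsPow f (T x) p).toReal) (cocompact X) (nhds 0)) ↔
    IsC0Schatten f p T := by
  have hp0 : 0 < p := by linarith
  have hp' : 0 < 1 / p := one_div_pos.2 hp0
  constructor
  · rintro ⟨hfin, hcont, hzero⟩
    refine ⟨hfin, fun x => ?_, ?_⟩
    · have htr : Tendsto (fun y => trAbsPow f (T y) p) (𝓝 x) (𝓝 (trAbsPow f (T x) p)) :=
        (ENNReal.tendsto_toReal_iff hfin (hfin x)).1 (hcont.tendsto x)
      have h := tendsto_trAbsPow_sub_rpow f hp hbound (hbound x)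
        (fun h => (hstrong h).1.tendsto x) (fun h => (hstrong h).2.tendsto x) hfin (hfin x) htr
      simp_rw [sNorm_eq_toReal]
      simpa [Function.comp_def] using (ENNReal.tendsto_toReal ENNReal.zero_ne_top).comp h
    · have h := hzero.rpow_const (.inr hp'.le)
      rwa [Real.zero_rpow hp'.ne'] at h
  · rintro ⟨hfin, hcont, hzero⟩
    have hs : Continuous fun x => sNorm f p (T x) := by
      refine continuous_iff_continuousAt.2 fun x => tendsto_iff_dist_tendsto_zero.2 ?_
      refine squeeze_zero (fun _ => dist_nonneg) (fun y => ?_) (hcont x)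
      exact abs_sNorm_sub_sNorm_le f hp (hfin y) (hfin x)
    simp_rw [← sNorm_rpow f hp]
    refine ⟨hfin, hs.rpow_const fun _ => .inr hp0.le, ?_⟩
    simpa [Real.zero_rpow hp0.ne'] using hzero.rpow_const (.inr hp0.le)

end
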